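/- arXiv:1905.02047 — 6 statements merged into one kernel-verified Lean document; each statement's English description precedes it below -/
import Mathlib

section
/- Let v : V → ℂ be any solution of the Dirichlet problem. Then Σ_{x∈V} v(x) ρ_{x a₀} = Δ_ρ v(a₀) = −Δ_ρ v(a₁) = (1/2) Σ_{x,y∈V} (∇_{xy}v)(∇_{xy}u) ρ_{xy} for every function u : V → ℂ with u(a₀) = 0 and u(a₁) = 1. -/
open Finset

/-- Discrete Green formula for the weighted Laplace operator on a finite set. -/
lemma sum_gradient_mul_gradient {V R : Type*} [Fintype V] [CommRing R]
    (ρ : V → V → R) (hsym : ∀ x y, ρ x y = ρ y x) (v w : V → R) :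
    ∑ x, ∑ y, (v y - v x) * (w y - w x) * ρ x y
      = -2 * ∑ x, w x * ∑ y, (v y - v x) * ρ x y := by
  have hswap : ∑ x, ∑ y, (v y - v x) * w y * ρ x y
      = -∑ x, ∑ y, (v y - v x) * w x * ρ x y := by
    rw [Finset.sum_comm, ← Finset.sum_neg_distrib]
    refine Finset.sum_congr rfl fun x _ => ?_
    rw [← Finset.sum_neg_distrib]
    refine Finset.sum_congr rfl fun y _ => ?_
    rw [hsym y x]
    ring
  have hpull : ∑ x, w x * ∑ y, (v y - v x) * ρ x y
      = ∑ x, ∑ y, (v y - v x) * w x * ρ x y := by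
    simp only [Finset.mul_sum]
    refine Finset.sum_congr rfl fun x _ => Finset.sum_congr rfl fun y _ => ?_
    ring
  simp only [mul_sub (_ - _), sub_mul _ _ (ρ _ _), Finset.sum_sub_distrib] at hswap hpull ⊢
  linear_combination hswap + 2 * hpull

/-- For any solution `v` of the Dirichlet problem,
`Σ_x v(x) ρ_{x a₀} = Δ_ρ v(a₀) = −Δ_ρ v(a₁) = (1/2) Σ_{x,y} (∇v)(∇u) ρ`
for every `u` with `u a₀ = 0`, `u a₁ = 1`. -/
theorem admittance_identities {V : Type*} [Fintype V]
    (ρ : V → V → ℂ) (hsym : ∀ x y, ρ x y = ρ y x) (hdiag : ∀ x, ρ x x = 0)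
    (a₀ a₁ : V) (hne : a₀ ≠ a₁)
    (v : V → ℂ)
    (hv : ∀ x, x ≠ a₀ → x ≠ a₁ → ∑ y, (v y - v x) * ρ x y = 0)
    (hv0 : v a₀ = 0) (hv1 : v a₁ = 1)
    (u : V → ℂ) (hu0 : u a₀ = 0) (hu1 : u a₁ = 1) :
    ∑ x, v x * ρ x a₀ = ∑ y, (v y - v a₀) * ρ a₀ y ∧
    ∑ y, (v y - v a₀) * ρ a₀ y = -∑ y, (v y - v a₁) * ρ a₁ y ∧
    ∑ y, (v y - v a₀) * ρ a₀ y
      = (1/2) * ∑ x, ∑ y, (v y - v x) * (u y - u x) * ρ x y := by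
  have hsum : ∀ w : V → ℂ, ∑ x, w x * ∑ y, (v y - v x) * ρ x y
      = w a₀ * ∑ y, (v y - v a₀) * ρ a₀ y + w a₁ * ∑ y, (v y - v a₁) * ρ a₁ y := fun w =>
    Fintype.sum_eq_add a₀ a₁ hne fun x hx => by rw [hv x hx.1 hx.2, mul_zero]
  have hzero : ∑ y, (v y - v a₀) * ρ a₀ y + ∑ y, (v y - v a₁) * ρ a₁ y = 0 := by
    have hgreen := sum_gradient_mul_gradient ρ hsym v (fun _ => 1)
    rw [hsum] at hgreen
    simpa using hgreen
  refine ⟨?_, eq_neg_of_add_eq_zero_left hzero, ?_⟩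
  · refine Finset.sum_congr rfl fun x _ => ?_
    rw [hv0, sub_zero, hsym]
  · rw [sum_gradient_mul_gradient ρ hsym v u, hsum, hu0, hu1]
    linear_combination hzero
end

section
/- The effective admittance is independent of the choice of solution: if v₁ and v₂ are two solutions of the Dirichlet problem, then Σ_{x∈V} v₁(x) ρ_{x a₀} = Σ_{x∈V} v₂(x) ρ_{x a₀}. -/
open Finset

/-- Green's identity for the Laplace operator of a symmetric weight. -/
theorem sum_mul_laplace_comm {V R : Type*} [Fintype V] [CommRing R]
    (ρ : V → V → R) (hsym : ∀ x y, ρ x y = ρ y x) (f g : V → R) :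
    ∑ x, f x * ∑ y, (g y - g x) * ρ x y = ∑ x, g x * ∑ y, (f y - f x) * ρ x y := by
  have hswap : ∑ x, ∑ y, f x * g y * ρ x y = ∑ x, ∑ y, g x * f y * ρ x y := by
    rw [Finset.sum_comm]
    refine Finset.sum_congr rfl fun x _ => Finset.sum_congr rfl fun y _ => ?_
    rw [hsym y x]
    ring
  rw [← sub_eq_zero] at hswap ⊢
  rw [← hswap]
  simp only [Finset.mul_sum, ← Finset.sum_sub_distrib]
  refine Finset.sum_congr rfl fun x _ => Finset.sum_congr rfl fun y _ => ?_
  ring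

/-- Testing the Laplacian of `g` against `f - 1` leaves only the term at `a₀`. -/
theorem sum_sub_one_mul_laplace {V R : Type*} [Fintype V] [CommRing R]
    (ρ : V → V → R) (hsym : ∀ x y, ρ x y = ρ y x) (a₀ a₁ : V) (f g : V → R)
    (hf0 : f a₀ = 0) (hf1 : f a₁ = 1) (hg0 : g a₀ = 0)
    (hg : ∀ x, x ≠ a₀ → x ≠ a₁ → ∑ y, (g y - g x) * ρ x y = 0) :
    ∑ x, (f x - 1) * ∑ y, (g y - g x) * ρ x y = -∑ x, g x * ρ x a₀ := by
  rw [Finset.sum_eq_single a₀]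
  · simp [hf0, hg0, hsym a₀]
  · intro x _ hx
    by_cases hx1 : x = a₁
    · simp [hx1, hf1]
    · rw [hg x hx hx1, mul_zero]
  · simp

/-- The effective admittance does not depend on the choice of a solution
of the Dirichlet problem. -/
theorem admittance_well_defined {V : Type*} [Fintype V]
    (ρ : V → V → ℂ) (hsym : ∀ x y, ρ x y = ρ y x) (hdiag : ∀ x, ρ x x = 0)
    (a₀ a₁ : V) (hne : a₀ ≠ a₁)
    (v₁ v₂ : V → ℂ)
    (hv₁ : ∀ x, x ≠ a₀ → x ≠ a₁ → ∑ y, (v₁ y - v₁ x) * ρ x y = 0)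
    (hv₁0 : v₁ a₀ = 0) (hv₁1 : v₁ a₁ = 1)
    (hv₂ : ∀ x, x ≠ a₀ → x ≠ a₁ → ∑ y, (v₂ y - v₂ x) * ρ x y = 0)
    (hv₂0 : v₂ a₀ = 0) (hv₂1 : v₂ a₁ = 1) :
    ∑ x, v₁ x * ρ x a₀ = ∑ x, v₂ x * ρ x a₀ := by
  have h := sum_mul_laplace_comm ρ hsym (fun x => v₁ x - 1) (fun x => v₂ x - 1)
  simp only [sub_sub_sub_cancel_right] at h
  rw [sum_sub_one_mul_laplace ρ hsym a₀ a₁ v₁ v₂ hv₁0 hv₁1 hv₂0 hv₂,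
    sum_sub_one_mul_laplace ρ hsym a₀ a₁ v₂ v₁ hv₂0 hv₂1 hv₁0 hv₁] at h
  exact (neg_injective h).symm
end

section
/- Conservation of complex power: if v : V → ℂ is a solution of the Dirichlet problem, then (1/2) Σ_{x,y∈V} |∇_{xy}v|² ρ_{xy} = 𝒫_eff, where |∇_{xy}v|² = (∇_{xy}v) · conj(∇_{xy}v). -/
/-- Green's formula for a symmetric weight on a finite set. -/
theorem sum_sum_sub_mul_sub_mul_eq {V R : Type*} [Fintype V] [CommRing R]
    (ρ : V → V → R) (hsym : ∀ x y, ρ x y = ρ y x) (f g : V → R) :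
    ∑ x, ∑ y, (f y - f x) * (g y - g x) * ρ x y
      = -2 * ∑ x, g x * ∑ y, (f y - f x) * ρ x y := by
  have hswap : ∑ x, ∑ y, (f y - f x) * g y * ρ x y
      = -∑ x, ∑ y, (f y - f x) * g x * ρ x y := by
    rw [Finset.sum_comm]
    simp only [← Finset.sum_neg_distrib]
    refine Finset.sum_congr rfl fun x _ => Finset.sum_congr rfl fun y _ => ?_
    rw [hsym y x]
    ring
  have hsplit : ∑ x, ∑ y, (f y - f x) * (g y - g x) * ρ x y
      = ∑ x, ∑ y, (f y - f x) * g y * ρ x y - ∑ x, ∑ y, (f y - f x) * g x * ρ x y := by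
    simp only [← Finset.sum_sub_distrib, mul_sub, sub_mul]
  have hpull : ∑ x, g x * ∑ y, (f y - f x) * ρ x y
      = ∑ x, ∑ y, (f y - f x) * g x * ρ x y := by
    refine Finset.sum_congr rfl fun x _ => ?_
    rw [Finset.mul_sum]
    exact Finset.sum_congr rfl fun y _ => by ring
  rw [hsplit, hswap, hpull]
  ring

open Finset

/-- Conservation of the complex power:
`(1/2) Σ_{x,y} |∇_{xy}v|² ρ_{xy} = 𝒫_eff`. -/
theorem conservation_of_complex_power {V : Type*} [Fintype V]
    (ρ : V → V → ℂ) (hsym : ∀ x y, ρ x y = ρ y x) (hdiag : ∀ x, ρ x x = 0)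
    (a₀ a₁ : V) (hne : a₀ ≠ a₁)
    (v : V → ℂ)
    (hv : ∀ x, x ≠ a₀ → x ≠ a₁ → ∑ y, (v y - v x) * ρ x y = 0)
    (hv0 : v a₀ = 0) (hv1 : v a₁ = 1) :
    (1/2) * ∑ x, ∑ y, (v y - v x) * (starRingEnd ℂ) (v y - v x) * ρ x y
      = ∑ x, v x * ρ x a₀ := by
  have hgreen := sum_sum_sub_mul_sub_mul_eq ρ hsym v fun x => 1 - (starRingEnd ℂ) (v x)
  have hboundary : ∑ x, (1 - (starRingEnd ℂ) (v x)) * ∑ y, (v y - v x) * ρ x y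
      = ∑ x, v x * ρ x a₀ := by
    rw [Finset.sum_eq_single a₀]
    · simp [hv0, hsym a₀]
    · intro x _ hx
      by_cases hx1 : x = a₁
      · simp [hx1, hv1]
      · rw [hv x hx hx1, mul_zero]
    · simp
  have hneg : ∑ x, ∑ y, (v y - v x) * (starRingEnd ℂ) (v y - v x) * ρ x y
      = -∑ x, ∑ y, (v y - v x)
          * ((1 - (starRingEnd ℂ) (v y)) - (1 - (starRingEnd ℂ) (v x))) * ρ x y := by
    simp only [← Finset.sum_neg_distrib, map_sub]
    exact Finset.sum_congr rfl fun x _ => Finset.sum_congr rfl fun y _ => by ring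
  rw [hneg, hgreen, hboundary]
  ring
end

section
/- If Re ρ_{xy} ≥ 0 for all x,y ∈ V, then any solution v of the Dirichlet problem satisfies Re 𝒫_eff ≥ 0, where 𝒫_eff = Σ_{x∈V} v(x) ρ_{x a₀} (equivalently, the effective impedance Z_eff = 1/𝒫_eff has Re Z_eff ≥ 0 when 𝒫_eff ≠ 0). -/
open Finset

/-- Green's identity for the weighted Laplacian on a finite set. -/
theorem two_mul_sum_mul_laplacian {V R : Type*} [Fintype V] [CommRing R]
    (ρ : V → V → R) (hsym : ∀ x y, ρ x y = ρ y x) (f g : V → R) :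
    2 * ∑ x, g x * ∑ y, (f y - f x) * ρ x y =
      ∑ x, ∑ y, (g x - g y) * (f y - f x) * ρ x y := by
  have swap : ∑ x, g x * ∑ y, (f y - f x) * ρ x y =
      ∑ x, ∑ y, g y * ((f x - f y) * ρ x y) := by
    simp_rw [mul_sum]
    rw [sum_comm]
    simp_rw [hsym]
  rw [two_mul]
  nth_rewrite 2 [swap]
  simp_rw [mul_sum, ← sum_add_distrib]
  refine sum_congr rfl fun x _ => sum_congr rfl fun y _ => ?_
  ring

/-- If all admittances have a nonnegative real part, then the effective
admittance has a nonnegative real part. -/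
theorem re_admittance_nonneg {V : Type*} [Fintype V]
    (ρ : V → V → ℂ) (hsym : ∀ x y, ρ x y = ρ y x) (hdiag : ∀ x, ρ x x = 0)
    (hre : ∀ x y, 0 ≤ (ρ x y).re)
    (a₀ a₁ : V) (hne : a₀ ≠ a₁)
    (v : V → ℂ)
    (hv : ∀ x, x ≠ a₀ → x ≠ a₁ → ∑ y, (v y - v x) * ρ x y = 0)
    (hv0 : v a₀ = 0) (hv1 : v a₁ = 1) :
    0 ≤ (∑ x, v x * ρ x a₀).re := by
  have boundary : ∑ x, (1 - starRingEnd ℂ (v x)) * ∑ y, (v y - v x) * ρ x y =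
      ∑ x, v x * ρ x a₀ := by
    rw [sum_eq_single a₀]
    · simp [hv0, hsym a₀]
    · intro x _ hx
      by_cases hx1 : x = a₁
      · simp [hx1, hv1]
      · rw [hv x hx hx1, mul_zero]
    · simp
  have energy : 2 * ∑ x, v x * ρ x a₀ =
      ∑ x, ∑ y, (Complex.normSq (v y - v x) : ℂ) * ρ x y := by
    rw [← boundary, two_mul_sum_mul_laplacian ρ hsym]
    refine sum_congr rfl fun x _ => sum_congr rfl fun y _ => ?_
    rw [Complex.normSq_eq_conj_mul_self, map_sub]
    ring
  have energy_re : 2 * (∑ x, v x * ρ x a₀).re =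
      ∑ x, ∑ y, Complex.normSq (v y - v x) * (ρ x y).re := by
    have h := congrArg Complex.re energy
    rw [two_mul, Complex.add_re, ← two_mul] at h
    simpa only [Complex.re_sum, Complex.re_ofReal_mul] using h
  have energy_nonneg : 0 ≤ ∑ x, ∑ y, Complex.normSq (v y - v x) * (ρ x y).re :=
    sum_nonneg fun x _ => sum_nonneg fun y _ => mul_nonneg (Complex.normSq_nonneg _) (hre x y)
  linarith
end

section
/- For any electrical network, the set of exceptional frequencies is finite: the set of λ ∈ ℂ with λ ≠ 0 and L_{xy}λ² + R_{xy}λ + D_{xy} ≠ 0 for every edge xy, such that the Dirichlet problem with complex weights ρ_{xy}(λ) = λ/(L_{xy}λ² + R_{xy}λ + D_{xy}) does NOT have a unique solution v : V → ℂ, is a finite subset of ℂ. -/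
open Finset

open Polynomial in
/-- The denominator `L λ² + R λ + D` of an admittance, as a polynomial in `λ`. -/
noncomputable def impedancePoly (r l d : ℝ) : ℂ[X] :=
  C (l : ℂ) * X ^ 2 + C (r : ℂ) * X + C (d : ℂ)

open Polynomial in
theorem eval_impedancePoly (r l d : ℝ) (z : ℂ) :
    (impedancePoly r l d).eval z = (l : ℂ) * z ^ 2 + (r : ℂ) * z + (d : ℂ) := by
  simp [impedancePoly]

open Polynomial in
/-- The admittances of a network multiplied by the common denominator, as polynomials. -/
noncomputable def clearedWeight {V : Type*} [Fintype V] [DecidableEq V]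
    (G : SimpleGraph V) [DecidableRel G.Adj] (R L D : V → V → ℝ) (x y : V) : ℂ[X] :=
  if G.Adj x y then
    X * ∏ q ∈ (univ.filter fun q : V × V => G.Adj q.1 q.2).erase (x, y),
      impedancePoly (R q.1 q.2) (L q.1 q.2) (D q.1 q.2)
  else 0

/-- The matrix of the Dirichlet problem with weights `w`: rows of the Laplacian at interior
vertices, rows of the identity at the two boundary vertices. -/
def dirichletMatrix {V S : Type*} [Fintype V] [DecidableEq V] [CommRing S] (a₀ a₁ : V)
    (w : V → V → S) : Matrix V V S :=
  fun x y => if x = a₀ ∨ x = a₁ then (if x = y then 1 else 0)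
    else w x y - if x = y then ∑ z, w x z else 0

section DirichletMatrix

variable {V S T : Type*} [Fintype V] [DecidableEq V] [CommRing S] [CommRing T]

theorem dirichletMatrix_mulVec (a₀ a₁ : V) (w : V → V → S) (v : V → S) (x : V) :
    (dirichletMatrix a₀ a₁ w).mulVec v x =
      if x = a₀ ∨ x = a₁ then v x else ∑ y, (v y - v x) * w x y := by
  simp only [Matrix.mulVec, dotProduct, dirichletMatrix]
  split_ifs with h
  · simp
  · simp only [sub_mul, ite_mul, zero_mul, sum_sub_distrib, sum_ite_eq, mem_univ, if_true,
      sum_mul]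
    congr 1 <;> exact sum_congr rfl fun y _ => mul_comm _ _

theorem map_det_dirichletMatrix (a₀ a₁ : V) (w : V → V → S) (f : S →+* T) :
    f (dirichletMatrix a₀ a₁ w).det = (dirichletMatrix a₀ a₁ fun x y => f (w x y)).det := by
  rw [RingHom.map_det]
  congr 1
  ext x y
  simp only [RingHom.mapMatrix_apply, Matrix.map_apply, dirichletMatrix]
  split_ifs <;> simp

theorem existsUnique_of_det_dirichletMatrix_ne_zero {K : Type*} [Field K] {a₀ a₁ : V}
    (hne : a₀ ≠ a₁) (w : V → V → K) (h : (dirichletMatrix a₀ a₁ w).det ≠ 0) :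
    ∃! v : V → K, (∀ x, x ≠ a₀ → x ≠ a₁ → ∑ y, (v y - v x) * w x y = 0) ∧
      v a₀ = 0 ∧ v a₁ = 1 := by
  have key : ∀ v : V → K, ((∀ x, x ≠ a₀ → x ≠ a₁ → ∑ y, (v y - v x) * w x y = 0) ∧
      v a₀ = 0 ∧ v a₁ = 1) ↔ (dirichletMatrix a₀ a₁ w).mulVec v = Pi.single a₁ 1 := by
    intro v
    rw [funext_iff]
    simp only [dirichletMatrix_mulVec]
    constructor
    · rintro ⟨h1, h2, h3⟩ x
      by_cases hx0 : x = a₀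
      · subst hx0; simp [h2, hne]
      by_cases hx1 : x = a₁
      · subst hx1; simp [h3]
      simp [hx0, hx1, h1 x hx0 hx1]
    · intro h
      refine ⟨fun x hx0 hx1 => ?_, ?_, ?_⟩
      · simpa [hx0, hx1] using h x
      · simpa [hne] using h a₀
      · simpa using h a₁
  have hunit : IsUnit (dirichletMatrix a₀ a₁ w) :=
    (Matrix.isUnit_iff_isUnit_det _).2 (isUnit_iff_ne_zero.2 h)
  simp only [key]
  exact (show Function.Bijective (dirichletMatrix a₀ a₁ w).mulVec from
    ⟨Matrix.mulVec_injective_iff_isUnit.2 hunit,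
      Matrix.mulVec_surjective_iff_isUnit.2 hunit⟩).existsUnique _

end DirichletMatrix

/-- Positive symmetric weights on a connected graph: the energy argument. -/
theorem det_dirichletMatrix_ne_zero_of_pos {V : Type*} [Fintype V] [DecidableEq V]
    (G : SimpleGraph V) (hconn : G.Connected) (a₀ a₁ : V) (c : V → V → ℝ)
    (hsymm : ∀ x y, c x y = c y x) (hpos : ∀ x y, G.Adj x y → 0 < c x y)
    (hnonneg : ∀ x y, 0 ≤ c x y) :
    (dirichletMatrix a₀ a₁ c).det ≠ 0 := by
  intro h
  obtain ⟨v, hv0, hv⟩ := Matrix.exists_mulVec_eq_zero_iff.2 h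
  have hrow : ∀ x, v x * ∑ y, (v y - v x) * c x y = 0 := by
    intro x
    have hx := congrFun hv x
    rw [dirichletMatrix_mulVec] at hx
    split_ifs at hx
    · rw [hx]; simp
    · rw [hx]; simp
  have ha₀ : v a₀ = 0 := by
    have hx := congrFun hv a₀
    simpa [dirichletMatrix_mulVec] using hx
  have h1 : ∑ x, ∑ y, v x * ((v y - v x) * c x y) = 0 :=
    sum_eq_zero fun x _ => by rw [← mul_sum]; exact hrow x
  have h2 : ∑ x, ∑ y, v y * ((v x - v y) * c x y) = 0 := by
    rw [sum_comm, ← h1]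
    exact sum_congr rfl fun x _ => sum_congr rfl fun y _ => by rw [hsymm]
  have energy : ∑ x, ∑ y, c x y * (v x - v y) ^ 2 = 0 := by
    have hsum : ∑ x, ∑ y, c x y * (v x - v y) ^ 2 =
        -(∑ x, ∑ y, v x * ((v y - v x) * c x y)) -
          ∑ x, ∑ y, v y * ((v x - v y) * c x y) := by
      simp only [← sum_neg_distrib, ← sum_sub_distrib]
      exact sum_congr rfl fun x _ => sum_congr rfl fun y _ => by ring
    rw [hsum, h1, h2]; simp
  have hterm : ∀ x y, 0 ≤ c x y * (v x - v y) ^ 2 :=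
    fun x y => mul_nonneg (hnonneg x y) (sq_nonneg _)
  have hadj : ∀ x y, G.Adj x y → v x = v y := by
    intro x y hxy
    have hx := (sum_eq_zero_iff_of_nonneg fun x _ => sum_nonneg fun y _ => hterm x y).1
      energy x (mem_univ x)
    have hxy' := (sum_eq_zero_iff_of_nonneg fun y _ => hterm x y).1 hx y (mem_univ y)
    rcases mul_eq_zero.1 hxy' with h0 | h0
    · exact absurd h0 (hpos x y hxy).ne'
    · exact sub_eq_zero.1 (pow_eq_zero_iff two_ne_zero |>.1 h0)
  have hconst : ∀ x y, v x = v y := by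
    intro x y
    obtain ⟨p⟩ := hconn.preconnected x y
    induction p with
    | nil => rfl
    | cons hxy _ ih => exact (hadj _ _ hxy).trans ih
  exact hv0 (funext fun x => (hconst x a₀).trans ha₀)

section ClearedWeight

variable {V : Type*} [Fintype V] [DecidableEq V] (G : SimpleGraph V) [DecidableRel G.Adj]
  (R L D : V → V → ℝ)

theorem eval_clearedWeight {z : ℂ}
    (hz : ∀ x y, G.Adj x y → (L x y : ℂ) * z ^ 2 + (R x y : ℂ) * z + (D x y : ℂ) ≠ 0)
    (x y : V) :
    (clearedWeight G R L D x y).eval z =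
      (∏ q ∈ univ.filter fun q : V × V => G.Adj q.1 q.2,
        ((L q.1 q.2 : ℂ) * z ^ 2 + (R q.1 q.2 : ℂ) * z + (D q.1 q.2 : ℂ))) *
      (if G.Adj x y then z / ((L x y : ℂ) * z ^ 2 + (R x y : ℂ) * z + (D x y : ℂ)) else 0) := by
  unfold clearedWeight
  split_ifs with h
  · rw [← mul_prod_erase _ _ (show (x, y) ∈ univ.filter fun q : V × V => G.Adj q.1 q.2 by
      simpa using h)]
    have := hz x y h
    simp only [Polynomial.eval_mul, Polynomial.eval_X, Polynomial.eval_prod,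
      eval_impedancePoly]
    rw [mul_div_assoc', eq_div_iff this]
    ring
  · simp

end ClearedWeight

/-- For any electrical network, the set of nonzero frequencies `λ` (with all
edge denominators nonvanishing) at which the complex Dirichlet problem fails
to have a unique solution is finite. -/
theorem exceptional_frequencies_finite {V : Type*} [Fintype V] [DecidableEq V]
    (G : SimpleGraph V) [DecidableRel G.Adj] (hconn : G.Connected)
    (a₀ a₁ : V) (hne : a₀ ≠ a₁)
    (R L D : V → V → ℝ)
    (hRsym : ∀ x y, R x y = R y x) (hLsym : ∀ x y, L x y = L y x)
    (hDsym : ∀ x y, D x y = D y x)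
    (hR : ∀ x y, 0 ≤ R x y) (hL : ∀ x y, 0 ≤ L x y) (hD : ∀ x y, 0 ≤ D x y)
    (hnz : ∀ x y, G.Adj x y → R x y ^ 2 + L x y ^ 2 + D x y ^ 2 ≠ 0) :
    {lam : ℂ | lam ≠ 0 ∧
      (∀ x y, G.Adj x y →
        (L x y : ℂ) * lam ^ 2 + (R x y : ℂ) * lam + (D x y : ℂ) ≠ 0) ∧
      ¬ ∃! v : V → ℂ,
        (∀ x, x ≠ a₀ → x ≠ a₁ →
          ∑ y, (v y - v x) *
            (if G.Adj x y then
              lam / ((L x y : ℂ) * lam ^ 2 + (R x y : ℂ) * lam + (D x y : ℂ))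
            else 0) = 0) ∧
        v a₀ = 0 ∧ v a₁ = 1}.Finite := by
  set p := (dirichletMatrix a₀ a₁ (clearedWeight G R L D)).det with hp_def
  have heval : ∀ z : ℂ, p.eval z =
      (dirichletMatrix a₀ a₁ fun x y => (clearedWeight G R L D x y).eval z).det :=
    fun z => map_det_dirichletMatrix a₀ a₁ _ (Polynomial.evalRingHom z)
  have hden : ∀ x y, G.Adj x y → 0 < L x y + R x y + D x y := by
    intro x y hxy
    have h1 := hR x y
    have h2 := hL x y
    have h3 := hD x y
    refine lt_of_le_of_ne (by positivity) fun h => hnz x y hxy ?_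
    have e1 : R x y = 0 := by linarith
    have e2 : L x y = 0 := by linarith
    have e3 : D x y = 0 := by linarith
    simp [e1, e2, e3]
  have hp : p ≠ 0 := by
    intro hp0
    set P : ℝ := ∏ q ∈ univ.filter fun q : V × V => G.Adj q.1 q.2,
      (L q.1 q.2 + R q.1 q.2 + D q.1 q.2) with hP
    have hPpos : 0 < P := prod_pos fun q hq => hden _ _ (by simpa using hq)
    set c : V → V → ℝ := fun x y =>
      P * if G.Adj x y then 1 / (L x y + R x y + D x y) else 0 with hc
    have hcpos : ∀ x y, G.Adj x y → 0 < c x y := by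
      intro x y hxy
      have := hden x y hxy
      simp only [hc, if_pos hxy]
      positivity
    have hdet : (dirichletMatrix a₀ a₁ c).det ≠ 0 := by
      refine det_dirichletMatrix_ne_zero_of_pos G hconn a₀ a₁ c (fun x y => ?_) hcpos
        fun x y => ?_
      · simp only [hc, G.adj_comm x y, hRsym x y, hLsym x y, hDsym x y]
      · by_cases hxy : G.Adj x y
        · exact (hcpos x y hxy).le
        · simp [hc, hxy]
    have hw : (fun x y => (clearedWeight G R L D x y).eval 1) =
        fun x y => Complex.ofRealHom (c x y) := by
      funext x y
      rw [eval_clearedWeight]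
      · simp only [hc, hP]
        split_ifs <;> simp
      · intro x y hxy
        have := (hden x y hxy).ne'
        simp only [one_pow, mul_one]
        exact_mod_cast this
    have h1 := heval 1
    rw [hw, ← map_det_dirichletMatrix, hp0, Polynomial.eval_zero] at h1
    exact hdet (Complex.ofReal_eq_zero.1 h1.symm)
  refine (Polynomial.finite_setOfPred_isRoot hp).subset ?_
  rintro z ⟨-, hz, hnot⟩
  by_contra hroot
  have hdet : (dirichletMatrix a₀ a₁ fun x y => (clearedWeight G R L D x y).eval z).det ≠ 0 := by
    rw [← heval]; exact hroot
  have hprod : (∏ q ∈ univ.filter fun q : V × V => G.Adj q.1 q.2,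
      ((L q.1 q.2 : ℂ) * z ^ 2 + (R q.1 q.2 : ℂ) * z + (D q.1 q.2 : ℂ))) ≠ 0 :=
    prod_ne_zero_iff.2 fun q hq => hz _ _ (by simpa using hq)
  have hex := existsUnique_of_det_dirichletMatrix_ne_zero hne _ hdet
  simp only [eval_clearedWeight G R L D hz, mul_left_comm _ (∏ q ∈ _, _), ← mul_sum,
    mul_eq_zero, hprod, false_or] at hex
  refine hnot ?_
  simpa only [← mul_eq_zero] using hex
end

section
/- Compatibility of the two approaches: let v_K : V → ℝ(X) be the unique solution of the Dirichlet problem over the field ℝ(X) of real rational functions with weights ρ_{xy} = X/(L_{xy}X² + R_{xy}X + D_{xy}) on edges. Let λ ∈ ℂ be such that λ ≠ 0, L_{xy}λ² + R_{xy}λ + D_{xy} ≠ 0 for every edge xy, and for every x ∈ V the rational function v_K(x) can be evaluated at λ (its denominator does not vanish at λ). Then the function w : V → ℂ, w(x) = v_K(x) evaluated at λ, is a solution of the complex Dirichlet problem with weights ρ_{xy}(λ) = λ/(L_{xy}λ² + R_{xy}λ + D_{xy}); in particular, if the complex Dirichlet problem at λ has a unique solution, then the two effective admittances agree: Σ_{x∈V}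 w(x) ρ_{x a₀}(λ) equals the evaluation at λ of Σ_{x∈V} v_K(x) ρ_{x a₀}. -/
open Finset

namespace RatFunc

universe u

variable {K L : Type u} [Field K] [Field L]

/-- The rational function `r` can be evaluated at `a` (its reduced denominator does not vanish
there), with value `c`. -/
def HasEvalAt (f : K →+* L) (a : L) (r : RatFunc K) (c : L) : Prop :=
  r.denom.eval₂ f a ≠ 0 ∧ r.eval f a = c

namespace HasEvalAt

variable {f : K →+* L} {a : L} {r s : RatFunc K} {c d : L}

theorem add (hr : HasEvalAt f a r c) (hs : HasEvalAt f a s d) : HasEvalAt f a (r + s) (c + d) := by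
  refine ⟨fun h => ?_, by rw [eval_add f a hr.1 hs.1, hr.2, hs.2]⟩
  have := Polynomial.eval₂_eq_zero_of_dvd_of_eval₂_eq_zero f a (denom_add_dvd r s) h
  rw [Polynomial.eval₂_mul] at this
  exact mul_ne_zero hr.1 hs.1 this

theorem mul (hr : HasEvalAt f a r c) (hs : HasEvalAt f a s d) : HasEvalAt f a (r * s) (c * d) := by
  refine ⟨fun h => ?_, by rw [eval_mul f a hr.1 hs.1, hr.2, hs.2]⟩
  have := Polynomial.eval₂_eq_zero_of_dvd_of_eval₂_eq_zero f a (denom_mul_dvd r s) h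
  rw [Polynomial.eval₂_mul] at this
  exact mul_ne_zero hr.1 hs.1 this

theorem of_polynomial (p : Polynomial K) :
    HasEvalAt f a (algebraMap (Polynomial K) (RatFunc K) p) (p.eval₂ f a) := by
  simp [HasEvalAt]

theorem zero : HasEvalAt f a 0 0 := by
  simp [HasEvalAt]

theorem sub (hr : HasEvalAt f a r c) (hs : HasEvalAt f a s d) : HasEvalAt f a (r - s) (c - d) := by
  simpa [sub_eq_add_neg] using hr.add ((of_polynomial (-1)).mul hs)

theorem sum {ι : Type*} {t : Finset ι} {g : ι → RatFunc K} {e : ι → L}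
    (h : ∀ i ∈ t, HasEvalAt f a (g i) (e i)) : HasEvalAt f a (∑ i ∈ t, g i) (∑ i ∈ t, e i) := by
  classical
  induction t using Finset.induction_on with
  | empty => simpa using zero
  | insert i t hi ih =>
    rw [Finset.sum_insert hi, Finset.sum_insert hi]
    exact (h i (Finset.mem_insert_self i t)).add
      (ih fun j hj => h j (Finset.mem_insert_of_mem hj))

theorem of_polynomial_div (p : Polynomial K) {q : Polynomial K} (hq : q.eval₂ f a ≠ 0) :
    HasEvalAt f a (algebraMap _ (RatFunc K) p / algebraMap _ (RatFunc K) q)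
      (p.eval₂ f a / q.eval₂ f a) := by
  have hden := fun h => hq
    (Polynomial.eval₂_eq_zero_of_dvd_of_eval₂_eq_zero f a (denom_div_dvd p q) h)
  have hq0 : algebraMap _ (RatFunc K) q ≠ 0 :=
    algebraMap_ne_zero fun h => hq (by rw [h, Polynomial.eval₂_zero])
  refine ⟨hden, ?_⟩
  have hmul := (HasEvalAt.mul ⟨hden, rfl⟩ (of_polynomial q)).2
  rw [div_mul_cancel₀ _ hq0, (of_polynomial p).2] at hmul
  exact (eq_div_iff hq).2 hmul.symm

end HasEvalAt

end RatFunc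

/-- The admittance `X / (l X² + r X + d)` of an edge evaluates as expected away from its poles. -/
theorem hasEvalAt_admittance {l r d : ℝ} {z : ℂ} (h : (l : ℂ) * z ^ 2 + (r : ℂ) * z + (d : ℂ) ≠ 0) :
    RatFunc.HasEvalAt (algebraMap ℝ ℂ) z
      (RatFunc.X / (RatFunc.C l * RatFunc.X ^ 2 + RatFunc.C r * RatFunc.X + RatFunc.C d))
      (z / ((l : ℂ) * z ^ 2 + (r : ℂ) * z + (d : ℂ))) := by
  have key := RatFunc.HasEvalAt.of_polynomial_div (f := algebraMap ℝ ℂ) (a := z) Polynomial.X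
    (q := Polynomial.C l * Polynomial.X ^ 2 + Polynomial.C r * Polynomial.X + Polynomial.C d)
    (by simpa using h)
  simpa using key

/-- Compatibility of the two approaches: evaluating at `λ` the unique solution
of the Dirichlet problem over the field `ℝ(X)` of rational functions yields a
solution of the complex Dirichlet problem at `λ` (provided `λ ≠ 0`, no edge
denominator vanishes at `λ`, and each `v_K(x)` can be evaluated at `λ`); in
particular, when the complex Dirichlet problem at `λ` is uniquely solvable the
two effective admittances agree. -/
theorem two_definitions_compatible {V : Type*} [Fintype V] [DecidableEq V]
    (G : SimpleGraph V) [DecidableRel G.Adj] (hconn : G.Connected)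
    (a₀ a₁ : V) (hne : a₀ ≠ a₁)
    (R L D : V → V → ℝ)
    (hRsym : ∀ x y, R x y = R y x) (hLsym : ∀ x y, L x y = L y x)
    (hDsym : ∀ x y, D x y = D y x)
    (hR : ∀ x y, 0 ≤ R x y) (hL : ∀ x y, 0 ≤ L x y) (hD : ∀ x y, 0 ≤ D x y)
    (hnz : ∀ x y, G.Adj x y → R x y ^ 2 + L x y ^ 2 + D x y ^ 2 ≠ 0)
    -- the solution of the Dirichlet problem over `ℝ(X)`
    (vK : V → RatFunc ℝ)
    (hvK : ∀ x, x ≠ a₀ → x ≠ a₁ →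
      ∑ y, (vK y - vK x) *
        (if G.Adj x y then
          RatFunc.X / (RatFunc.C (L x y) * RatFunc.X ^ 2 +
            RatFunc.C (R x y) * RatFunc.X + RatFunc.C (D x y))
        else 0) = 0)
    (hvK0 : vK a₀ = 0) (hvK1 : vK a₁ = 1)
    -- the evaluation point
    (lam : ℂ) (hlam : lam ≠ 0)
    (hedge : ∀ x y, G.Adj x y →
      (L x y : ℂ) * lam ^ 2 + (R x y : ℂ) * lam + (D x y : ℂ) ≠ 0)
    (hden : ∀ x, Polynomial.eval₂ (algebraMap ℝ ℂ) lam (vK x).denom ≠ 0) :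
    -- the evaluated function solves the complex Dirichlet problem at `lam`
    ((∀ x, x ≠ a₀ → x ≠ a₁ →
        ∑ y, (RatFunc.eval (algebraMap ℝ ℂ) lam (vK y) -
              RatFunc.eval (algebraMap ℝ ℂ) lam (vK x)) *
          (if G.Adj x y then
            lam / ((L x y : ℂ) * lam ^ 2 + (R x y : ℂ) * lam + (D x y : ℂ))
          else 0) = 0) ∧
      RatFunc.eval (algebraMap ℝ ℂ) lam (vK a₀) = 0 ∧
      RatFunc.eval (algebraMap ℝ ℂ) lam (vK a₁) = 1) ∧
    -- in particular, if the complex Dirichlet problem at `lam` has a unique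
    -- solution, then the two effective admittances agree
    ((∃! w : V → ℂ,
        (∀ x, x ≠ a₀ → x ≠ a₁ →
          ∑ y, (w y - w x) *
            (if G.Adj x y then
              lam / ((L x y : ℂ) * lam ^ 2 + (R x y : ℂ) * lam + (D x y : ℂ))
            else 0) = 0) ∧
        w a₀ = 0 ∧ w a₁ = 1) →
      ∑ x, RatFunc.eval (algebraMap ℝ ℂ) lam (vK x) *
          (if G.Adj x a₀ then
            lam / ((L x a₀ : ℂ) * lam ^ 2 + (R x a₀ : ℂ) * lam + (D x a₀ : ℂ))
          else 0)
        = RatFunc.eval (algebraMap ℝ ℂ) lam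
            (∑ x, vK x *
              (if G.Adj x a₀ then
                RatFunc.X / (RatFunc.C (L x a₀) * RatFunc.X ^ 2 +
                  RatFunc.C (R x a₀) * RatFunc.X + RatFunc.C (D x a₀))
              else 0))) := by
  have hv : ∀ x, RatFunc.HasEvalAt (algebraMap ℝ ℂ) lam (vK x)
      (RatFunc.eval (algebraMap ℝ ℂ) lam (vK x)) := fun x => ⟨hden x, rfl⟩
  have hρ : ∀ x y, RatFunc.HasEvalAt (algebraMap ℝ ℂ) lam
      (if G.Adj x y then
        RatFunc.X / (RatFunc.C (L x y) * RatFunc.X ^ 2 +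
          RatFunc.C (R x y) * RatFunc.X + RatFunc.C (D x y))
      else 0)
      (if G.Adj x y then
        lam / ((L x y : ℂ) * lam ^ 2 + (R x y : ℂ) * lam + (D x y : ℂ))
      else 0) := by
    intro x y
    split_ifs with hxy
    · exact hasEvalAt_admittance (hedge x y hxy)
    · exact RatFunc.HasEvalAt.zero
  refine ⟨⟨fun x hx0 hx1 => ?_, by rw [hvK0, RatFunc.eval_zero], by rw [hvK1, RatFunc.eval_one]⟩,
    fun _ => ?_⟩
  · rw [← (RatFunc.HasEvalAt.sum fun y _ => ((hv y).sub (hv x)).mul (hρ x y)).2, hvK x hx0 hx1,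
      RatFunc.eval_zero]
  · exact (RatFunc.HasEvalAt.sum fun x _ => (hv x).mul (hρ x a₀)).2.symm
end
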